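/- Suppose l(p) = 0. Then γ'''(p) = (1/y(p))·( l''(p)·R_{−η(p)}·U(p) − 2·l'(p)·η'(p)·R_{−η(p)+π/2}·U(p) ). -/

import Mathlib

open Real

/-- Rotation of the plane by angle `θ`. -/
noncomputable def rot (θ : ℝ) (v : ℝ × ℝ) : ℝ × ℝ :=
  (Real.cos θ * v.1 - Real.sin θ * v.2, Real.sin θ * v.1 + Real.cos θ * v.2)

/-- Determinant of the 2×2 matrix with columns `v`, `w`. -/
def det2 (v w : ℝ × ℝ) : ℝ := v.1 * w.2 - v.2 * w.1

open intervalIntegral in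
theorem hasDerivAt_of_eq_integral {f g : ℝ → ℝ} (hg : Continuous g)
    (hf : ∀ t, f t = ∫ u in (0:ℝ)..t, g u) (t : ℝ) : HasDerivAt f (g t) t := by
  rw [funext hf]
  exact integral_hasDerivAt_right (hg.intervalIntegrable _ _)
    (hg.stronglyMeasurableAtFilter _ _) hg.continuousAt

theorem contDiff_of_eq_integral {f g : ℝ → ℝ} (hg : ContDiff ℝ (⊤ : ℕ∞) g)
    (hf : ∀ t, f t = ∫ u in (0:ℝ)..t, g u) : ContDiff ℝ (⊤ : ℕ∞) f := by
  have hd := hasDerivAt_of_eq_integral hg.continuous hf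
  rw [contDiff_infty_iff_deriv]
  refine ⟨fun t => (hd t).differentiableAt, ?_⟩
  rwa [funext fun t => (hd t).deriv]

/-- If `γ' = l • w` and `l p = 0`, then `γ''' p = l'' p • w p + 2 l' p • w' p`. -/
theorem iteratedDeriv_three_of_hasDerivAt_smul {E : Type*} [NormedAddCommGroup E]
    [NormedSpace ℝ E] {γ w : ℝ → E} {l : ℝ → ℝ} (hl : ContDiff ℝ 2 l) (hw : ContDiff ℝ 2 w)
    (hγ : ∀ t, HasDerivAt γ (l t • w t) t) {p : ℝ} (hlp : l p = 0) :
    iteratedDeriv 3 γ p = iteratedDeriv 2 l p • w p + (2 * deriv l p) • deriv w p := by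
  have hl₁ : Differentiable ℝ l := hl.differentiable (by norm_num)
  have hw₁ : Differentiable ℝ w := hw.differentiable (by norm_num)
  have hl₂ : Differentiable ℝ (deriv l) := hl.differentiable_deriv_two
  have hw₂ : Differentiable ℝ (deriv w) := hw.differentiable_deriv_two
  have h₁ : deriv γ = fun t => l t • w t := funext fun t => (hγ t).deriv
  have h₂ : deriv (fun t => l t • w t) = fun t => l t • deriv w t + deriv l t • w t :=
    funext fun t => ((hl₁ t).hasDerivAt.smul (hw₁ t).hasDerivAt).deriv
  have h₃ := (((hl₁ p).hasDerivAt.smul (hw₂ p).hasDerivAt).add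
    ((hl₂ p).hasDerivAt.smul (hw₁ p).hasDerivAt)).deriv
  have h₄ : iteratedDeriv 2 l p = deriv (deriv l) p := by
    rw [iteratedDeriv_succ, iteratedDeriv_one]
  have h₅ : iteratedDeriv 3 γ p = deriv (deriv (deriv γ)) p := by
    rw [iteratedDeriv_succ, iteratedDeriv_succ, iteratedDeriv_one]
  rw [h₅, h₁, h₂, h₄]
  refine h₃.trans ?_
  rw [hlp]
  module

/-- At a singular point `p`,
`γ'''(p) = (1/y(p)) (l''(p) R_{−η(p)} U(p) − 2 l'(p) η'(p) R_{−η(p)+π/2} U(p))`. -/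
theorem third_deriv_at_singular_point
    (l h : ℝ → ℝ) (hl : ContDiff ℝ (⊤ : ℕ∞) l) (hh : ContDiff ℝ (⊤ : ℕ∞) h)
    (η F G : ℝ → ℝ)
    (hη : ∀ u, η u = ∫ v in (0:ℝ)..u, 2 * h v)
    (hF : ∀ t, F t = ∫ u in (0:ℝ)..t, l u * sin (η u))
    (hG : ∀ t, G t = ∫ u in (0:ℝ)..t, l u * cos (η u))
    (c₁ c₂ : ℝ)
    (hpos : ∀ t, 0 < (F t - c₁) ^ 2 + (G t - c₂) ^ 2)
    (y x : ℝ → ℝ)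
    (hy : ∀ t, y t = Real.sqrt ((F t - c₁) ^ 2 + (G t - c₂) ^ 2))
    (hx : ∀ t, x t = ∫ u in (0:ℝ)..t,
      (deriv F u * (G u - c₂) - deriv G u * (F u - c₁)) / y u)
    (γ : ℝ → ℝ × ℝ) (hγ : ∀ t, γ t = (x t, y t))
    (U : ℝ → ℝ × ℝ) (hU : ∀ t, U t = (-(F t - c₁), G t - c₂))
    (p : ℝ) (hlp : l p = 0) :
    iteratedDeriv 3 γ p = (1 / y p) •
      (iteratedDeriv 2 l p • rot (-(η p)) (U p)
        - (2 * deriv l p * deriv η p) • rot (-(η p) + Real.pi / 2) (U p)) := by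
  have hηs : ContDiff ℝ (⊤ : ℕ∞) η := contDiff_of_eq_integral (contDiff_const.mul hh) hη
  have hFs' : ContDiff ℝ (⊤ : ℕ∞) fun u => l u * sin (η u) := hl.mul hηs.sin
  have hGs' : ContDiff ℝ (⊤ : ℕ∞) fun u => l u * cos (η u) := hl.mul hηs.cos
  have hFs := contDiff_of_eq_integral hFs' hF
  have hGs := contDiff_of_eq_integral hGs' hG
  have hFd := hasDerivAt_of_eq_integral hFs'.continuous hF
  have hGd := hasDerivAt_of_eq_integral hGs'.continuous hG
  have hηd : HasDerivAt η (deriv η p) p :=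
    (hηs.differentiable (by simp) p).hasDerivAt
  have hy0 : ∀ t, y t ≠ 0 := fun t => by
    rw [hy]; exact (Real.sqrt_pos.2 (hpos t)).ne'
  have hys : ContDiff ℝ (⊤ : ℕ∞) y := by
    rw [funext hy]
    exact (((hFs.sub contDiff_const).pow 2).add ((hGs.sub contDiff_const).pow 2)).sqrt
      fun t => (hpos t).ne'
  have hyd : ∀ t, HasDerivAt y
      (l t * ((sin (η t) * (F t - c₁) + cos (η t) * (G t - c₂)) / y t)) t := fun t => by
    have h := ((((hFd t).sub_const c₁).pow 2).add (((hGd t).sub_const c₂).pow 2)).sqrt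
      (hpos t).ne'
    have hy' : y = fun t => √((F t - c₁) ^ 2 + (G t - c₂) ^ 2) := funext hy
    have h0 := hy0 t
    rw [hy'] at h0 ⊢
    refine h.congr_deriv ?_
    simp only [Pi.add_apply, Pi.pow_apply] at h0 ⊢
    field_simp
    ring
  have hxd : ∀ t, HasDerivAt x
      (l t * ((sin (η t) * (G t - c₂) - cos (η t) * (F t - c₁)) / y t)) t := fun t => by
    have hx' : ∀ t, x t = ∫ u in (0:ℝ)..t,
        l u * ((sin (η u) * (G u - c₂) - cos (η u) * (F u - c₁)) / y u) := fun t => by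
      rw [hx]
      congr 1
      funext u
      rw [(hFd u).deriv, (hGd u).deriv]
      ring
    refine hasDerivAt_of_eq_integral (hl.continuous.mul (Continuous.div₀ ?_ hys.continuous hy0))
      hx' t
    exact ((hηs.sin.mul (hGs.sub contDiff_const)).sub
      (hηs.cos.mul (hFs.sub contDiff_const))).continuous
  have hγd : ∀ t, HasDerivAt γ
      (l t • ((sin (η t) * (G t - c₂) - cos (η t) * (F t - c₁)) / y t,
        (sin (η t) * (F t - c₁) + cos (η t) * (G t - c₂)) / y t)) t := fun t => by
    rw [funext hγ]
    exact (hxd t).prodMk (hyd t)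
  have hws : ContDiff ℝ (⊤ : ℕ∞) fun t =>
      ((sin (η t) * (G t - c₂) - cos (η t) * (F t - c₁)) / y t,
        (sin (η t) * (F t - c₁) + cos (η t) * (G t - c₂)) / y t) :=
    (((hηs.sin.mul (hGs.sub contDiff_const)).sub
      (hηs.cos.mul (hFs.sub contDiff_const))).div hys hy0).prodMk
    (((hηs.sin.mul (hFs.sub contDiff_const)).add
      (hηs.cos.mul (hGs.sub contDiff_const))).div hys hy0)
  have hFp : HasDerivAt (fun t => F t - c₁) 0 p := by
    simpa [hlp] using (hFd p).sub_const c₁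
  have hGp : HasDerivAt (fun t => G t - c₂) 0 p := by
    simpa [hlp] using (hGd p).sub_const c₂
  have hyp : HasDerivAt y 0 p := by simpa [hlp] using hyd p
  have hwd := ((((hηd.sin.mul hGp).sub (hηd.cos.mul hFp)).div hyp (hy0 p)).prodMk
    (((hηd.sin.mul hFp).add (hηd.cos.mul hGp)).div hyp (hy0 p))).deriv
  rw [iteratedDeriv_three_of_hasDerivAt_smul (contDiff_infty.1 hl 2)
    (contDiff_infty.1 hws 2) hγd hlp]
  erw [hwd]
  have h0 := hy0 p
  ext <;>
  · simp only [rot, hU, Real.cos_add_pi_div_two, Real.sin_add_pi_div_two, Real.cos_neg,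
      Real.sin_neg, Prod.fst_add, Prod.snd_add, Prod.smul_fst, Prod.smul_snd, Prod.fst_sub,
      Prod.snd_sub, smul_eq_mul, Pi.add_apply, Pi.sub_apply, Pi.mul_apply]
    field_simp
    ring
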